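/- Let G be the 7 × 7 real symmetric matrix with all diagonal entries equal to 1 and off-diagonal entries (symmetrically extended) G₁₂ = −1, G₁₃ = −(cos(π/5) + √15/3), G₂₄ = −(cos(π/5) + √15/3), G₁₄ = −cos(π/5), G₂₃ = −cos(π/5), G₃₅ = −1/2, G₄₇ = −1/2, G₅₆ = −1/2, G₆₇ = −1/2, G₅₇ = −1/2, and all other off-diagonal entries 0. Then G has exactly 4 positive eigenvalues (with multiplicity), exactly 1 negative eigenvalue, and exactly 2 zero eigenvalues; equivalently G has rank 5 and signature (4,1). -/

import Mathlib

open Real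

noncomputable def G5 : Matrix (Fin 7) (Fin 7) ℝ :=
  !![1, -1, -(Real.cos (Real.pi / 5) + Real.sqrt 15 / 3), -(Real.cos (Real.pi / 5)), 0, 0, 0;
     -1, 1, -(Real.cos (Real.pi / 5)), -(Real.cos (Real.pi / 5) + Real.sqrt 15 / 3), 0, 0, 0;
     -(Real.cos (Real.pi / 5) + Real.sqrt 15 / 3), -(Real.cos (Real.pi / 5)), 1, 0, -(1/2), 0, 0;
     -(Real.cos (Real.pi / 5)), -(Real.cos (Real.pi / 5) + Real.sqrt 15 / 3), 0, 1, 0, 0, -(1/2);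
     0, 0, -(1/2), 0, 1, -(1/2), -(1/2);
     0, 0, 0, 0, -(1/2), 1, -(1/2);
     0, 0, 0, -(1/2), -(1/2), -(1/2), 1]

open scoped Matrix

/-- A real symmetric matrix that is positive definite on the range of `P` has at least as many
positive eigenvalues as `P` has columns. -/
theorem Matrix.IsHermitian.card_le_card_pos_eigenvalues {m n : Type*} [Fintype m] [Fintype n]
    [DecidableEq n] {A : Matrix n n ℝ} (hA : A.IsHermitian) (P : Matrix n m ℝ)
    (hP : (Pᵀ * A * P).PosDef) :
    Fintype.card m ≤ (Finset.univ.filter fun j => 0 < hA.eigenvalues j).card := by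
  let U : Matrix n n ℝ := hA.eigenvectorUnitary
  let S := {j // 0 < hA.eigenvalues j}
  let M : Matrix S m ℝ := (Uᵀ * P).submatrix Subtype.val id
  have hspec : A = U * Matrix.diagonal hA.eigenvalues * Uᵀ := by
    have := hA.spectral_theorem
    rw [Unitary.conjStarAlgAut_apply] at this
    simpa [Function.comp_def, Matrix.star_eq_conjTranspose] using! this
  have hinj : Function.Injective M.mulVecLin := by
    rw [injective_iff_map_eq_zero]
    intro x hx
    by_contra hx0
    have hpos := hP.dotProduct_mulVec_pos hx0
    have hform : star x ⬝ᵥ ((Pᵀ * A * P) *ᵥ x) =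
        ∑ j, hA.eigenvalues j * ((Uᵀ * P) *ᵥ x) j ^ 2 := by
      have hmat : Pᵀ * A * P = (Uᵀ * P)ᵀ * Matrix.diagonal hA.eigenvalues * (Uᵀ * P) := by
        conv_lhs => rw [hspec]
        simp only [Matrix.transpose_mul, Matrix.transpose_transpose, Matrix.mul_assoc]
      rw [hmat]
      generalize Uᵀ * P = Q
      rw [Matrix.mul_assoc, ← Matrix.mulVec_mulVec, Matrix.dotProduct_mulVec,
        Matrix.vecMul_transpose, ← Matrix.mulVec_mulVec, dotProduct]
      refine Finset.sum_congr rfl fun j _ => ?_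
      rw [Matrix.mulVec_diagonal, star_trivial]
      ring
    refine hpos.not_ge (hform.trans_le (Finset.sum_nonpos fun j _ => ?_))
    by_cases hj : 0 < hA.eigenvalues j
    · have : ((Uᵀ * P) *ᵥ x) j = 0 := congrFun hx ⟨j, hj⟩
      simp [this]
    · exact mul_nonpos_of_nonpos_of_nonneg (not_lt.mp hj) (sq_nonneg _)
  simpa [S, Fintype.card_subtype] using LinearMap.finrank_le_finrank_of_injective hinj

/-- A positive definite principal submatrix bounds the number of positive eigenvalues below. -/
theorem Matrix.IsHermitian.card_le_card_pos_eigenvalues_of_submatrix {m n : Type*} [Fintype m]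
    [Fintype n] [DecidableEq n] {A : Matrix n n ℝ} (hA : A.IsHermitian) (e : m → n)
    (he : (A.submatrix e e).PosDef) :
    Fintype.card m ≤ (Finset.univ.filter fun j => 0 < hA.eigenvalues j).card := by
  refine hA.card_le_card_pos_eigenvalues ((1 : Matrix n n ℝ).submatrix id e) ?_
  convert he
  ext i j
  simp [Matrix.mul_apply, Matrix.one_apply]

theorem G5_posDef_submatrix (hG : G5.IsHermitian) :
    (G5.submatrix ![2, 3, 4, 5] ![2, 3, 4, 5]).PosDef := by
  refine Matrix.PosDef.of_dotProduct_mulVec_pos (hG.submatrix _) fun x hx => ?_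
  have hform : star x ⬝ᵥ (G5.submatrix ![2, 3, 4, 5] ![2, 3, 4, 5] *ᵥ x) =
      x 1 ^ 2 + (x 0 - x 2 / 2) ^ 2 + 3 / 4 * (x 2 - 2 / 3 * x 3) ^ 2 + 2 / 3 * x 3 ^ 2 := by
    simp [G5, dotProduct, Matrix.mulVec, Fin.sum_univ_four]
    ring
  rw [hform]
  refine lt_of_le_of_ne (by positivity) fun h => hx ?_
  have h3 : x 3 = 0 := by
    nlinarith [sq_nonneg (x 1), sq_nonneg (x 0 - x 2 / 2),
      sq_nonneg (x 2 - 2 / 3 * x 3), sq_nonneg (x 3)]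
  have h2 : x 2 = 0 := by rw [h3] at h; nlinarith [sq_nonneg (x 1), sq_nonneg (x 0 - x 2 / 2)]
  have h1 : x 1 = 0 := by rw [h3, h2] at h; nlinarith [sq_nonneg (x 1), sq_nonneg (x 0)]
  have h0 : x 0 = 0 := by rw [h3, h2, h1] at h; nlinarith [sq_nonneg (x 0)]
  ext i
  fin_cases i <;> assumption

theorem G5_not_posSemidef : ¬ G5.PosSemidef := by
  intro h
  have hv := h.dotProduct_mulVec_nonneg ![1, 0, 1, 0, 0, 0, 0]
  have hform : star ![1, 0, 1, 0, 0, 0, 0] ⬝ᵥ (G5 *ᵥ ![1, 0, 1, 0, 0, 0, 0]) =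
      2 - 2 * (cos (π / 5) + √15 / 3) := by
    simp [G5, dotProduct, Matrix.mulVec, Fin.sum_univ_succ]
    ring
  rw [hform, cos_pi_div_five] at hv
  have h5 : 1 ≤ √5 := Real.one_le_sqrt.mpr (by norm_num)
  have h15 : 3 ≤ √15 := Real.le_sqrt_of_sq_le (by norm_num)
  linarith

theorem G5_rank_le : G5.rank ≤ 5 := by
  let u : ℝ := -2 * (2 * cos (π / 5) + √15 / 3)
  let K : Matrix (Fin 7) (Fin 2) ℝ :=
    !![1, √15 / 2; 1, -(√15 / 2); 0, 3; 0, -3; u, 1; u, 0; u, -1]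
  have hGK : G5 * K = 0 := by
    have h15 : √15 * √15 = 15 := Real.mul_self_sqrt (by norm_num)
    ext i j
    fin_cases i <;> fin_cases j <;>
      simp [G5, K, u, Matrix.mul_apply, Fin.sum_univ_succ] <;> linarith
  have hK : K.rank = 2 := by
    let L : Matrix (Fin 2) (Fin 7) ℝ :=
      !![1 / 2, 1 / 2, 0, 0, 0, 0, 0; 0, 0, 1 / 3, 0, 0, 0, 0]
    have hLK : L * K = 1 := by
      ext i j
      fin_cases i <;> fin_cases j <;>
        norm_num [L, K, Matrix.mul_apply, Fin.sum_univ_succ]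
    refine le_antisymm K.rank_le_width ?_
    simpa [hLK] using Matrix.rank_mul_le_right L K
  have := Matrix.rank_add_rank_le_card_of_mul_eq_zero hGK
  simp only [hK, Fintype.card_fin] at this
  omega

theorem stmt_5 (hG : G5.IsHermitian) :
    (Finset.univ.filter fun j => 0 < hG.eigenvalues j).card = 4 ∧
    (Finset.univ.filter fun j => hG.eigenvalues j < 0).card = 1 ∧
    (Finset.univ.filter fun j => hG.eigenvalues j = 0).card = 2 ∧
    G5.rank = 5 := by
  have hpos : 4 ≤ (Finset.univ.filter fun j => 0 < hG.eigenvalues j).card := by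
    simpa using hG.card_le_card_pos_eigenvalues_of_submatrix _ (G5_posDef_submatrix hG)
  have hneg : 0 < (Finset.univ.filter fun j => hG.eigenvalues j < 0).card := by
    by_contra! h
    refine G5_not_posSemidef (hG.posSemidef_iff_eigenvalues_nonneg.mpr fun j => ?_)
    by_contra! hj
    exact (Finset.card_pos.mpr ⟨j, by simpa using hj⟩).not_ge h
  have hrank : G5.rank = (Finset.univ.filter fun j => 0 < hG.eigenvalues j).card +
      (Finset.univ.filter fun j => hG.eigenvalues j < 0).card := by
    rw [hG.rank_eq_card_non_zero_eigs, Fintype.card_subtype, ← Finset.card_union_of_disjoint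
      (Finset.disjoint_filter.mpr fun _ _ h => h.not_gt), ← Finset.filter_or]
    simp only [ne_iff_lt_or_gt, or_comm]
  have hzero : (Finset.univ.filter fun j => hG.eigenvalues j = 0).card + G5.rank = 7 := by
    rw [hG.rank_eq_card_non_zero_eigs, Fintype.card_subtype]
    simpa using Finset.card_filter_add_card_filter_not (s := Finset.univ)
      fun j => hG.eigenvalues j = 0
  have := G5_rank_le
  omega
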